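/- For any set of typing statements Γ, terms P, Q, S and variable x with x ∉ F(Γ) ∪ F(Q): if Γ ∪ {(x:Q)} ⊨ (S:P) then Γ ⊨ (λxQS : πxQP), where πxQP abbreviates ρλxQP. -/

import Mathlib

namespace Paper

/-- Terms of the bare bones dependent type system (Part 1): constants `c n`,
variables `v n`, dependent products `ρR`, applications `βRS` and abstractions `λxRS`. -/
inductive Tm : Type
  | const : ℕ → Tm
  | var : ℕ → Tm
  | rho : Tm → Tm
  | app : Tm → Tm → Tm
  | lam : ℕ → Tm → Tm → Tm
  deriving DecidableEq

namespace Tm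

/-- The size of a term. -/
def size : Tm → ℕ
  | const _ => 1
  | var _ => 1
  | rho R => R.size + 1
  | app R S => R.size + S.size + 1
  | lam _ R S => R.size + S.size + 1

/-- The free variables `F(T)` of a term. -/
def fv : Tm → Finset ℕ
  | const _ => ∅
  | var x => {x}
  | rho R => R.fv
  | app R S => R.fv ∪ S.fv
  | lam x R S => R.fv ∪ (S.fv \ {x})

/-- The bound variables `B(T)` of a term. -/
def bv : Tm → Finset ℕ
  | const _ => ∅
  | var _ => ∅
  | rho R => R.bv
  | app R S => R.bv ∪ S.bv
  | lam x R S => (R.bv ∪ S.bv) ∪ {x}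

/-- All variables `V(T) = F(T) ∪ B(T)` occurring in a term. -/
def vars (t : Tm) : Finset ℕ := t.fv ∪ t.bv

/-- A fixed choice of a variable outside a given finite set of variables. -/
def fresh (s : Finset ℕ) : ℕ := s.sup id + 1

theorem fresh_not_mem (s : Finset ℕ) : fresh s ∉ s := by
  intro h
  have := Finset.le_sup (f := id) h
  simp only [id] at this
  simp only [fresh] at this
  omega

/-- Capture-avoiding renaming `S[z/y]` (substitution of the variable `z` for the
variable `y`), implemented with a fuel parameter and carrying the fact that it
preserves the size of the term. -/
def renameAux : (n : ℕ) → (S : Tm) → S.size ≤ n → (z y : ℕ) → {t : Tm // t.size = S.size}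
  | _, const a, _, _, _ => ⟨const a, rfl⟩
  | _, var v, _, z, y => if v = y then ⟨var z, rfl⟩ else ⟨var v, rfl⟩
  | 0, rho _, h, _, _ => absurd h (by simp only [size]; omega)
  | n + 1, rho R, h, z, y =>
      let R' := renameAux n R (by simp only [size] at h; omega) z y
      ⟨rho R'.1, by simp only [size, R'.2]⟩
  | 0, app _ _, h, _, _ => absurd h (by simp only [size]; omega)
  | n + 1, app R S, h, z, y =>
      let R' := renameAux n R (by simp only [size] at h; omega) z y
      let S' := renameAux n S (by simp only [size] at h; omega) z y
      ⟨app R'.1 S'.1, by simp only [size, R'.2, S'.2]⟩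
  | 0, lam _ _ _, h, _, _ => absurd h (by simp only [size]; omega)
  | n + 1, lam w R S, h, z, y =>
      let R' := renameAux n R (by simp only [size] at h; omega) z y
      if w = y ∨ y ∉ S.fv then
        ⟨lam w R'.1 S, by simp only [size, R'.2]⟩
      else if w ≠ z then
        -- here `w ∉ F(z)`, so the chosen fresh variable is `w` itself
        let S' := renameAux n S (by simp only [size] at h; omega) z y
        ⟨lam w R'.1 S'.1, by simp only [size, R'.2, S'.2]⟩
      else
        let z' := fresh ((var z).vars ∪ S.vars)
        let S₁ := renameAux n S (by simp only [size] at h; omega) z' w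
        let S₂ := renameAux n S₁.1 (by rw [S₁.2]; simp only [size] at h; omega) z y
        ⟨lam z' R'.1 S₂.1, by simp only [size, S₂.2, S₁.2, R'.2]⟩

/-- Capture-avoiding renaming `S[z/y]` of the variable `y` to the variable `z`. -/
def rename (S : Tm) (z y : ℕ) : Tm := (renameAux S.size S le_rfl z y).1

theorem size_rename (S : Tm) (z y : ℕ) : (rename S z y).size = S.size :=
  (renameAux S.size S le_rfl z y).2

/-- Capture-avoiding substitution `S[T/x]` of the term `T` for the variable `x` in `S`,
renaming bound variables (using the fixed choice `fresh`) to avoid capture. -/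
def subst : Tm → Tm → ℕ → Tm
  | const a, _, _ => const a
  | var v, T, x => if v = x then T else var v
  | rho R, T, x => rho (subst R T x)
  | app R S, T, x => app (subst R T x) (subst S T x)
  | lam w R S, T, x =>
      if w = x ∨ x ∉ S.fv then lam w (subst R T x) S
      else if w ∉ T.fv then lam w (subst R T x) (subst S T x)
      else lam (fresh (T.vars ∪ S.vars)) (subst R T x)
        (subst (rename S (fresh (T.vars ∪ S.vars)) w) T x)
termination_by S _ _ => S.size
decreasing_by all_goals (simp only [size, size_rename]; omega)

end Tm

end Paper
namespace Paper

open ZFSet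

/-- The application `R(s) = ⋃ R{s} = ⋃ {r | ⟨r,s⟩ ∈ R}` of a set to a set
(ordered pairs `⟨r,s⟩` are Kuratowski pairs `ZFSet.pair r s`). -/
noncomputable def sApp (R s : ZFSet.{0}) : ZFSet :=
  ⋃₀ (ZFSet.sep (fun r => ZFSet.pair r s ∈ R) (⋃₀ (⋃₀ R)))

/-- The domain `dom(S) = {d | ∃ r, ⟨r,d⟩ ∈ S}` of a set. -/
noncomputable def sDom (S : ZFSet.{0}) : ZFSet :=
  ZFSet.sep (fun d => ∃ r, ZFSet.pair r d ∈ S) (⋃₀ (⋃₀ S))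

/-- The range `ran(S) = {r | ∃ d, ⟨r,d⟩ ∈ S}` of a set. -/
noncomputable def sRan (S : ZFSet.{0}) : ZFSet :=
  ZFSet.sep (fun r => ∃ d, ZFSet.pair r d ∈ S) (⋃₀ (⋃₀ S))

/-- `F` is a function: a set of ordered pairs `⟨value, argument⟩` which, for each
`d` in its domain, contains a unique pair with second component `d`. -/
def IsFun (F : ZFSet.{0}) : Prop :=
  (∀ p ∈ F, ∃ r d, p = ZFSet.pair r d) ∧
    ∀ d r r', ZFSet.pair r d ∈ F → ZFSet.pair r' d ∈ F → r = r'

/-- The dependent product `∏F`: the set of all functions `f` with `dom f = dom F`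
such that `f(d) ∈ F(d)` for every `d ∈ dom F` (with the paper's convention that
functions are sets of pairs `⟨value, argument⟩`). -/
noncomputable def dprod (F : ZFSet.{0}) : ZFSet :=
  ZFSet.sep
    (fun f => IsFun f ∧ sDom f = sDom F ∧ ∀ d ∈ sDom F, sApp f d ∈ sApp F d)
    (ZFSet.powerset (ZFSet.prod (⋃₀ (sRan F)) (sDom F)))

/-- The set `{⟨f r, r⟩ : r ∈ X}`, i.e. the graph (in the paper's convention) of the
function sending each `r ∈ X` to `f r`. -/
noncomputable def lamSet (X : ZFSet.{0}) (f : ZFSet.{0} → ZFSet.{0}) : ZFSet :=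
  @ZFSet.image (fun r => ZFSet.pair (f r) r) (Classical.allZFSetDefinable _) X

/-- An assignment of sets to the constants and the variables. -/
structure Asn where
  c : ℕ → ZFSet.{0}
  v : ℕ → ZFSet.{0}

/-- The assignment modified to send the variable `x` to the set `s`. -/
noncomputable def Asn.update (A : Asn) (x : ℕ) (s : ZFSet.{0}) : Asn :=
  ⟨A.c, Function.update A.v x s⟩

/-- The interpretation `⟦·⟧` of terms determined by an assignment:
`⟦ρS⟧ = ∏⟦S⟧`, `⟦βRS⟧ = ⟦R⟧(⟦S⟧)` and `⟦λxRS⟧ = {⟨⟦S⟧_{⟨r,x⟩}, r⟩ : r ∈ ⟦R⟧}`. -/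
noncomputable def interp : Tm → Asn → ZFSet
  | Tm.const a, A => A.c a
  | Tm.var x, A => A.v x
  | Tm.rho R, A => dprod (interp R A)
  | Tm.app R S, A => sApp (interp R A) (interp S A)
  | Tm.lam x R S, A => lamSet (interp R A) (fun r => interp S (A.update x r))

end Paper
namespace Paper

/-- The head α-conversion relation
`≡^α = {⟨λxRS, λyR(S[y/x])⟩ : x ∉ B(S) and y ∉ V(S)}`. -/
def HeadAlpha (A B : Tm) : Prop :=
  ∃ (x y : ℕ) (R S : Tm), x ∉ S.bv ∧ y ∉ S.vars ∧
    A = Tm.lam x R S ∧ B = Tm.lam y R (S.subst (Tm.var y) x)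

end Paper
namespace Paper

/-- The contextual closure of a relation on terms: the smallest relation
containing it such that `R ▷ C` implies `βSR ▷ βSC`, `βRS ▷ βCS`, `λxSR ▷ λxSC`,
`λxRS ▷ λxCS` and `ρR ▷ ρC`. -/
inductive Ctx (r : Tm → Tm → Prop) : Tm → Tm → Prop
  | base {R C : Tm} : r R C → Ctx r R C
  | appLeft {R C S : Tm} : Ctx r R C → Ctx r (Tm.app R S) (Tm.app C S)
  | appRight {R C S : Tm} : Ctx r R C → Ctx r (Tm.app S R) (Tm.app S C)
  | lamDom {R C S : Tm} {x : ℕ} : Ctx r R C → Ctx r (Tm.lam x R S) (Tm.lam x C S)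
  | lamBody {R C S : Tm} {x : ℕ} : Ctx r R C → Ctx r (Tm.lam x S R) (Tm.lam x S C)
  | rho {R C : Tm} : Ctx r R C → Ctx r (Tm.rho R) (Tm.rho C)

/-- α-conversion `≡_α`: the reflexive transitive contextual closure of
head α-conversion. -/
def AlphaEq : Tm → Tm → Prop := Relation.ReflTransGen (Ctx HeadAlpha)

end Paper
namespace Paper

/-- The setoid of α-conversion: the equivalence relation generated by the
contextual closure of head α-conversion (which coincides with `AlphaEq`). -/
def alphaSetoid : Setoid Tm := Relation.EqvGen.setoid (Ctx HeadAlpha)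

/-- α-equivalence classes of terms. -/
def QTm := Quotient alphaSetoid

/-- The α-equivalence class `[T]_α` of a term. -/
def cls (t : Tm) : QTm := Quotient.mk alphaSetoid t

/-- Typing statements `(S : P)`: pairs of α-equivalence classes of terms. -/
abbrev Stmt := QTm × QTm

/-- The free variables of an α-equivalence class, i.e. the union of the free
variables of its representatives (free variables are α-invariant). -/
def Fq (q : QTm) : Set ℕ := {v | ∃ T : Tm, cls T = q ∧ v ∈ T.fv}

/-- The free variables `F(Γ)` of a set of typing statements: the union of the
free variables of the subjects and predicates of its statements. -/
def FSet (Γ : Set Stmt) : Set ℕ := {v | ∃ st ∈ Γ, v ∈ Fq st.1 ∨ v ∈ Fq st.2}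

/-- The product term `πxRS := ρλxRS`. -/
def Tm.pi (x : ℕ) (R S : Tm) : Tm := Tm.rho (Tm.lam x R S)

end Paper
namespace Paper

/-- An interpretation satisfies the typing statement `(S : P)` iff `⟦S⟧ ∈ ⟦P⟧`
(this is independent of the choice of representatives, interpretations being
α-invariant). -/
def QSat (A : Asn) (st : Stmt) : Prop :=
  ∀ S P : Tm, st.1 = cls S → st.2 = cls P → interp S A ∈ interp P A

/-- An interpretation is a model for `Γ` iff it satisfies every statement in `Γ`. -/
def QModels (A : Asn) (Γ : Set Stmt) : Prop := ∀ st ∈ Γ, QSat A st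

/-- The consequence relation `Γ ⊨ X`: every model of `Γ` is a model of `X`. -/
def QConseq (Γ : Set Stmt) (st : Stmt) : Prop :=
  ∀ A : Asn, QModels A Γ → QSat A st

/-- `Γ ⊨ Δ` iff `Γ ⊨ X` for every `X ∈ Δ`. -/
def QConseqSet (Γ Δ : Set Stmt) : Prop := ∀ st ∈ Δ, QConseq Γ st

end Paper

namespace Paper

open ZFSet

theorem Asn.update_comm (A : Asn) {x y : ℕ} (hxy : x ≠ y) (r s : ZFSet.{0}) :
    (A.update x r).update y s = (A.update y s).update x r := by
  simp only [Asn.update, Function.update_comm hxy]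

theorem Asn.update_idem (A : Asn) (x : ℕ) (r s : ZFSet.{0}) :
    (A.update x r).update x s = A.update x s := by
  simp only [Asn.update, Function.update_idem]

theorem mem_lamSet {X : ZFSet.{0}} {f : ZFSet.{0} → ZFSet.{0}} {p : ZFSet.{0}} :
    p ∈ lamSet X f ↔ ∃ r ∈ X, pair (f r) r = p :=
  @ZFSet.mem_image _ (Classical.allZFSetDefinable _) X p

theorem pair_mem_lamSet {X : ZFSet.{0}} {f : ZFSet.{0} → ZFSet.{0}} {a d : ZFSet.{0}} :
    pair a d ∈ lamSet X f ↔ d ∈ X ∧ a = f d := by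
  rw [mem_lamSet]
  constructor
  · rintro ⟨r, hr, e⟩
    obtain ⟨rfl, rfl⟩ := pair_injective e
    exact ⟨hr, rfl⟩
  · rintro ⟨hd, rfl⟩
    exact ⟨d, hd, rfl⟩

theorem lamSet_congr {X : ZFSet.{0}} {f g : ZFSet.{0} → ZFSet.{0}} (h : ∀ r ∈ X, f r = g r) :
    lamSet X f = lamSet X g := by
  ext p
  simp only [mem_lamSet]
  exact exists_congr fun r => and_congr_right fun hr => by rw [h r hr]

theorem left_mem_sUnion_sUnion {R a d : ZFSet.{0}} (h : pair a d ∈ R) : a ∈ ⋃₀ (⋃₀ R) :=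
  mem_sUnion.2 ⟨{a}, mem_sUnion.2 ⟨_, h, by simp [pair]⟩, by simp⟩

theorem right_mem_sUnion_sUnion {R a d : ZFSet.{0}} (h : pair a d ∈ R) : d ∈ ⋃₀ (⋃₀ R) :=
  mem_sUnion.2 ⟨{a, d}, mem_sUnion.2 ⟨_, h, by simp [pair]⟩, by simp⟩

theorem mem_sDom {R d : ZFSet.{0}} : d ∈ sDom R ↔ ∃ r, pair r d ∈ R := by
  rw [sDom, mem_sep]
  exact and_iff_right_of_imp fun ⟨_, h⟩ => right_mem_sUnion_sUnion h

theorem mem_sRan {R r : ZFSet.{0}} : r ∈ sRan R ↔ ∃ d, pair r d ∈ R := by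
  rw [sRan, mem_sep]
  exact and_iff_right_of_imp fun ⟨_, h⟩ => left_mem_sUnion_sUnion h

theorem sDom_lamSet (X : ZFSet.{0}) (f : ZFSet.{0} → ZFSet.{0}) : sDom (lamSet X f) = X := by
  ext d
  simp [mem_sDom, pair_mem_lamSet]

theorem sApp_lamSet {X d : ZFSet.{0}} (f : ZFSet.{0} → ZFSet.{0}) (hd : d ∈ X) :
    sApp (lamSet X f) d = f d := by
  ext z
  rw [sApp, mem_sUnion]
  constructor
  · rintro ⟨r, hr, hz⟩
    rw [mem_sep] at hr
    rwa [(pair_mem_lamSet.1 hr.2).2] at hz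
  · intro hz
    have hp : pair (f d) d ∈ lamSet X f := pair_mem_lamSet.2 ⟨hd, rfl⟩
    exact ⟨f d, mem_sep.2 ⟨left_mem_sUnion_sUnion hp, hp⟩, hz⟩

theorem isFun_lamSet (X : ZFSet.{0}) (f : ZFSet.{0} → ZFSet.{0}) : IsFun (lamSet X f) := by
  refine ⟨fun p hp => ?_, fun d r r' h h' => ?_⟩
  · obtain ⟨r, -, rfl⟩ := mem_lamSet.1 hp
    exact ⟨_, _, rfl⟩
  · rw [(pair_mem_lamSet.1 h).2, (pair_mem_lamSet.1 h').2]

theorem lamSet_mem_dprod {X : ZFSet.{0}} {f g : ZFSet.{0} → ZFSet.{0}}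
    (h : ∀ r ∈ X, f r ∈ g r) : lamSet X f ∈ dprod (lamSet X g) := by
  rw [dprod, mem_sep, mem_powerset]
  refine ⟨fun p hp => ?_, isFun_lamSet X f, ?_, fun d hd => ?_⟩
  · obtain ⟨r, hr, rfl⟩ := mem_lamSet.1 hp
    rw [pair_mem_prod, sDom_lamSet]
    exact ⟨mem_sUnion.2 ⟨g r, mem_sRan.2 ⟨r, pair_mem_lamSet.2 ⟨hr, rfl⟩⟩, h r hr⟩, hr⟩
  · rw [sDom_lamSet, sDom_lamSet]
  · rw [sDom_lamSet] at hd
    rw [sApp_lamSet f hd, sApp_lamSet g hd]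
    exact h d hd

theorem interp_update_of_notMem_fv {T : Tm} {x : ℕ} (hx : x ∉ T.fv) (A : Asn) (s : ZFSet.{0}) :
    interp T (A.update x s) = interp T A := by
  induction T generalizing A with
  | const a => rfl
  | var y =>
    have hy : y ≠ x := fun e => hx (by simp [Tm.fv, e])
    simp [interp, Asn.update, hy]
  | rho R ih => rw [interp, interp, ih hx]
  | app R S ihR ihS =>
    simp only [Tm.fv, Finset.mem_union, not_or] at hx
    rw [interp, interp, ihR hx.1, ihS hx.2]
  | lam w R S ihR ihS =>
    simp only [Tm.fv, Finset.mem_union, Finset.mem_sdiff, Finset.mem_singleton, not_or,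
      not_and, not_not] at hx
    rw [interp, interp, ihR hx.1]
    refine lamSet_congr fun r _ => ?_
    by_cases hw : x = w
    · rw [hw, Asn.update_idem]
    · rw [Asn.update_comm A hw, ihS fun h => hw (hx.2 h)]

theorem interp_subst_var {S : Tm} {x y : ℕ} (hx : x ∉ S.bv) (hy : y ∉ S.bv) (A : Asn) :
    interp (S.subst (Tm.var y) x) A = interp S (A.update x (A.v y)) := by
  induction S generalizing A with
  | const a => simp [Tm.subst, interp, Asn.update]
  | var w =>
    by_cases hw : w = x
    · simp [Tm.subst, interp, Asn.update, hw]
    · simp [Tm.subst, interp, Asn.update, hw]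
  | rho R ih => rw [Tm.subst, interp, interp, ih hx hy]
  | app R S ihR ihS =>
    simp only [Tm.bv, Finset.mem_union, not_or] at hx hy
    rw [Tm.subst, interp, interp, ihR hx.1 hy.1, ihS hx.2 hy.2]
  | lam w R S ihR ihS =>
    simp only [Tm.bv, Finset.mem_union, Finset.mem_singleton, not_or] at hx hy
    obtain ⟨⟨hxR, hxS⟩, hxw⟩ := hx
    obtain ⟨⟨hyR, hyS⟩, hyw⟩ := hy
    rw [Tm.subst]
    by_cases hS : x ∈ S.fv
    · rw [if_neg (by simp [Ne.symm hxw, hS]), if_pos (by simp [Tm.fv, Ne.symm hyw]),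
        interp, interp, ihR hxR hyR]
      refine lamSet_congr fun r _ => ?_
      have hv : (A.update w r).v y = A.v y := by simp [Asn.update, hyw]
      rw [ihS hxS hyS, hv, Asn.update_comm A hxw]
    · rw [if_pos (Or.inr hS), interp, interp, ihR hxR hyR]
      refine lamSet_congr fun r _ => ?_
      rw [Asn.update_comm A hxw, interp_update_of_notMem_fv hS]

theorem HeadAlpha.interp_eq {T U : Tm} (h : HeadAlpha T U) (A : Asn) :
    interp T A = interp U A := by
  obtain ⟨x, y, R, S, hx, hy, rfl, rfl⟩ := h
  simp only [Tm.vars, Finset.mem_union, not_or] at hy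
  rw [interp, interp]
  refine lamSet_congr fun r _ => ?_
  have hv : (A.update y r).v y = r := by simp [Asn.update]
  rw [interp_subst_var hx hy.2, hv]
  by_cases hxy : y = x
  · rw [hxy, Asn.update_idem]
  · rw [Asn.update_comm A hxy, interp_update_of_notMem_fv hy.1]

theorem Ctx.interp_eq {T U : Tm} (h : Ctx HeadAlpha T U) (A : Asn) :
    interp T A = interp U A := by
  induction h generalizing A with
  | base h => exact h.interp_eq A
  | appLeft _ ih => rw [interp, interp, ih]
  | appRight _ ih => rw [interp, interp, ih]
  | lamDom _ ih => rw [interp, interp, ih]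
  | lamBody _ ih =>
    rw [interp, interp]
    exact lamSet_congr fun r _ => ih _
  | rho _ ih => rw [interp, interp, ih]

/-- The interpretation of a term depends only on its α-equivalence class. -/
theorem interp_eq_of_cls_eq {T U : Tm} (h : cls T = cls U) (A : Asn) :
    interp T A = interp U A := by
  have h' : Relation.EqvGen (Ctx HeadAlpha) T U := Quotient.exact h
  clear h
  induction h' with
  | rel _ _ h => exact h.interp_eq A
  | refl _ => rfl
  | symm _ _ _ ih => exact ih.symm
  | trans _ _ _ _ _ ih₁ ih₂ => exact ih₁.trans ih₂

theorem qSat_cls {A : Asn} {S P : Tm} : QSat A (cls S, cls P) ↔ interp S A ∈ interp P A := by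
  refine ⟨fun h => h S P rfl rfl, fun h S' P' hS hP => ?_⟩
  rwa [← interp_eq_of_cls_eq hS, ← interp_eq_of_cls_eq hP]

theorem QModels.update {A : Asn} {Γ : Set Stmt} (hA : QModels A Γ) {x : ℕ} (hx : x ∉ FSet Γ)
    (r : ZFSet.{0}) : QModels (A.update x r) Γ := by
  intro st hst S P hS hP
  rw [interp_update_of_notMem_fv fun h => hx ⟨st, hst, Or.inl ⟨S, hS.symm, h⟩⟩,
    interp_update_of_notMem_fv fun h => hx ⟨st, hst, Or.inr ⟨P, hP.symm, h⟩⟩]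
  exact hA st hst S P hS hP

/-- if `x ∉ F(Γ) ∪ F(Q)` and `Γ, (x:Q) ⊨ (S : P)` then
`Γ ⊨ (λxQS : πxQP)`. -/
theorem conseq_ab (Γ : Set Stmt) (P Q S : Tm) (x : ℕ)
    (hΓ : x ∉ FSet Γ) (hQ : x ∉ Q.fv)
    (h : QConseq (Γ ∪ {(cls (Tm.var x), cls Q)}) (cls S, cls P)) :
    QConseq Γ (cls (Tm.lam x Q S), cls (Tm.pi x Q P)) := by
  intro A hA
  rw [qSat_cls, Tm.pi, interp, interp, interp]
  refine lamSet_mem_dprod fun r hr => qSat_cls.1 (h _ ?_)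
  rintro st (hst | rfl)
  · exact hA.update hΓ r st hst
  · rw [qSat_cls, interp_update_of_notMem_fv hQ]
    simpa [interp, Asn.update] using hr

end Paper
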